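/- Fix κ ∈ (0,1), q ∈ [0,1], w > 0, and a finite Borel measure μ on [0,1] having a continuous, everywhere positive density with respect to Lebesgue measure. Let (f,a) be a feasible strategy profile with d₁ > 0 and d₂ > 0, and suppose 1−q > d₂/(κ(d₁+d₂)). Then a₁·(κq/P^{f,a} − 1) + a₂·(κ(1−q)/(1−P^{f,a}) − 1) = sup over b₁,b₂ ≥ 0 with b₁+b₂ ≤ w of [b₁·(κq(d₁+d₂+b₁+b₂)/(d₁+b₁) − 1) + b₂·(κ(1−q)(d₁+d₂+b₁+b₂)/(d₂+b₂) − 1)] holds if and only if a₁ = 0 and a₂ = min{w, √(κ·(1−q)·d₁·d₂/(1−κ(1−q))) − d₂}. -/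

import Mathlib

open MeasureTheory Set

noncomputable section

/-- `μ` is a finite Borel measure on `[0,1]` with a continuous, everywhere positive
density with respect to Lebesgue measure. -/
def NiceDensity (μ : Measure ℝ) : Prop :=
  ∃ g : ℝ → ℝ, ContinuousOn g (Icc 0 1) ∧ (∀ p ∈ Icc (0:ℝ) 1, 0 < g p) ∧
    μ = (volume.restrict (Icc (0:ℝ) 1)).withDensity (fun p => ENNReal.ofReal (g p))

/-- Total amount wagered by the diffuse players on Outcome 1. -/
def d1 (μ : Measure ℝ) (f : ℝ → ℝ × ℝ) : ℝ := ∫ p in Icc (0:ℝ) 1, (f p).1 ∂μ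

/-- Total amount wagered by the diffuse players on Outcome 2. -/
def d2 (μ : Measure ℝ) (f : ℝ → ℝ × ℝ) : ℝ := ∫ p in Icc (0:ℝ) 1, (f p).2 ∂μ

/-- The implied probability of Outcome 1, `P^{f,a}`. -/
def impliedProb (μ : Measure ℝ) (f : ℝ → ℝ × ℝ) (a : ℝ × ℝ) : ℝ :=
  (d1 μ f + a.1) / (d1 μ f + d2 μ f + a.1 + a.2)

/-- A feasible strategy profile for the diffuse players. -/
def FeasibleDiffuse (f : ℝ → ℝ × ℝ) : Prop :=
  Measurable f ∧ ∀ p ∈ Icc (0:ℝ) 1, 0 ≤ (f p).1 ∧ 0 ≤ (f p).2 ∧ (f p).1 + (f p).2 ≤ 1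

/-- A feasible strategy profile for the atomic player. -/
def FeasibleAtomic (w : ℝ) (a : ℝ × ℝ) : Prop := 0 ≤ a.1 ∧ 0 ≤ a.2 ∧ a.1 + a.2 ≤ w

/-- Payoff of the atomic player. -/
def payoff (α β D E b c : ℝ) : ℝ :=
  b * (α * (D + E + b + c) / (D + b) - 1) + c * (β * (D + E + b + c) / (E + c) - 1)

theorem payoff_eq (α β D E b c : ℝ) (hx : 0 < D + b) (hy : 0 < E + c) :
    payoff α β D E b c = (α + β - 1) * ((D + b) + (E + c)) - α * D * ((E + c) / (D + b))
      - β * E * ((D + b) / (E + c)) + (D + E - α * D - β * E) := by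
  unfold payoff
  field_simp
  ring

theorem payoff_one (α β D E s m c : ℝ) (hβ1 : β < 1) (hD : 0 < D) (hE : 0 < E)
    (hs : (1 - β) * s ^ 2 = β * D * E) (hc : 0 < E + c) (hm : 0 < E + m) :
    payoff α β D E 0 m - payoff α β D E 0 c
      = (1 - β) * ((c - m) * ((E + c) * (E + m) - s ^ 2)) / ((E + c) * (E + m)) := by
  unfold payoff
  field_simp
  linear_combination D * (c - m) * hs

theorem payoff_zero_lt (α β D E s w c : ℝ) (hβ1 : β < 1) (hD : 0 < D) (hE : 0 < E)
    (hs : (1 - β) * s ^ 2 = β * D * E) (hsE : E < s) (hc0 : 0 ≤ c) (hcw : c ≤ w)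
    (hne : c ≠ min w (s - E)) :
    payoff α β D E 0 c < payoff α β D E 0 (min w (s - E)) := by
  have hm0 : 0 ≤ min w (s - E) := le_min (by linarith) (by linarith)
  have h := payoff_one α β D E s (min w (s - E)) c hβ1 hD hE hs (by linarith) (by linarith)
  have hpos : 0 < (c - min w (s - E)) * ((E + c) * (E + min w (s - E)) - s ^ 2) := by
    rcases le_total w (s - E) with h1 | h1
    · rw [min_eq_left h1] at *
      have hlt : c < w := lt_of_le_of_ne hcw hne
      apply mul_pos_of_neg_of_neg (by linarith)
      nlinarith
    · rw [min_eq_right h1] at *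
      have : (c - (s - E)) * ((E + c) * (E + (s - E)) - s ^ 2) = s * (c - (s - E)) ^ 2 := by ring
      rw [this]
      have : c - (s - E) ≠ 0 := sub_ne_zero.mpr hne
      have : 0 < s := by linarith
      positivity
  have h2 : 0 < (E + c) * (E + min w (s - E)) := by
    apply mul_pos <;> linarith
  have : 0 < payoff α β D E 0 (min w (s - E)) - payoff α β D E 0 c := by
    rw [h]
    exact div_pos (mul_pos (by linarith) hpos) h2
  linarith

theorem payoff_reduce (α β D E b c : ℝ) (hα : 0 ≤ α) (hαβ : α + β < 1)
    (hD : 0 < D) (hE : 0 < E) (hβ : E < β * (D + E)) (hb : 0 < b) (hc : 0 ≤ c) :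
    ∃ c', 0 ≤ c' ∧ c' ≤ c ∧ payoff α β D E b c < payoff α β D E 0 c' := by
  have hx : 0 < D + b := by linarith
  have hy : 0 < E + c := by linarith
  rcases le_total ((D + b) * E) ((E + c) * D) with h | h
  · have e : E + ((E + c) * D / (D + b) - E) = (E + c) * D / (D + b) := by ring
    have hy' : 0 < (E + c) * D / (D + b) := by positivity
    have hle : (E + c) * D / (D + b) ≤ E + c := by
      rw [div_le_iff₀ hx]; nlinarith
    refine ⟨(E + c) * D / (D + b) - E, ?_, by linarith, ?_⟩
    · rw [sub_nonneg, le_div_iff₀ hx]; linarith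
    · rw [payoff_eq _ _ _ _ _ _ hx hy, payoff_eq _ _ _ _ _ _ (by linarith) (by rw [e]; exact hy'), e]
      have r1 : (E + c) * D / (D + b) / (D + 0) = (E + c) / (D + b) := by field_simp; ring
      have r2 : (D + 0) / ((E + c) * D / (D + b)) = (D + b) / (E + c) := by field_simp; ring
      rw [r1, r2]
      nlinarith
  · refine ⟨0, le_rfl, hc, ?_⟩
    have e : D + ((D + b) * E / (E + c) - D) = (D + b) * E / (E + c) := by ring
    set b' := (D + b) * E / (E + c) - D with hb'
    have hb'0 : 0 ≤ b' := by
      rw [hb', sub_nonneg, le_div_iff₀ hy]; linarith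
    have hle : (D + b) * E / (E + c) ≤ D + b := by
      rw [div_le_iff₀ hy]; nlinarith
    have h0 : payoff α β D E 0 0 = 0 := by simp [payoff]
    have hαD : α * (D + E) < D := by nlinarith
    have hα1 : α < 1 := by
      by_contra hcon
      nlinarith
    have hneg : ∀ t, 0 < t → payoff α β D E t 0 < 0 := by
      intro t ht
      have : α * (D + E + t + 0) / (D + t) - 1 < 0 := by
        rw [sub_neg, div_lt_one (by linarith)]
        nlinarith
      unfold payoff
      nlinarith
    have hscale : payoff α β D E b' 0 - payoff α β D E b c
        = (1 - α - β) * ((D + b) + (E + c) - ((D + b) * E / (E + c) + E)) := by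
      rw [payoff_eq _ _ _ _ _ _ hx hy, payoff_eq _ _ _ _ _ _ (by linarith) (by linarith), e]
      have r1 : (E + 0) / ((D + b) * E / (E + c)) = (E + c) / (D + b) := by field_simp; ring
      have r2 : ((D + b) * E / (E + c)) / (E + 0) = (D + b) / (E + c) := by field_simp; ring
      rw [r1, r2]
      ring
    rw [h0]
    rcases hc.eq_or_lt with hc0 | hc0
    · rw [← hc0]; exact hneg b hb
    · have h1 : 0 < (1 - α - β) * ((D + b) + (E + c) - ((D + b) * E / (E + c) + E)) :=
        mul_pos (by linarith) (by linarith)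
      rcases hb'0.eq_or_lt with hz | hz
      · rw [← hz, h0] at hscale; linarith
      · have := hneg b' hz; linarith

theorem payoff_lt (α β D E s w b c : ℝ) (hα : 0 ≤ α) (hαβ : α + β < 1)
    (hD : 0 < D) (hE : 0 < E) (hβ : E < β * (D + E))
    (hs : (1 - β) * s ^ 2 = β * D * E) (hsE : E < s) (hb : 0 ≤ b) (hc : 0 ≤ c) (hw : b + c ≤ w)
    (hne : ¬ (b = 0 ∧ c = min w (s - E))) :
    payoff α β D E b c < payoff α β D E 0 (min w (s - E)) := by
  rcases hb.eq_or_lt with h | h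
  · subst h
    exact payoff_zero_lt α β D E s w c (by linarith) hD hE hs hsE hc (by linarith)
      (fun h => hne ⟨rfl, h⟩)
  · obtain ⟨c', h1, h2, h3⟩ := payoff_reduce α β D E b c hα hαβ hD hE hβ h hc
    by_cases h4 : c' = min w (s - E)
    · rwa [← h4]
    · exact h3.trans (payoff_zero_lt α β D E s w c' (by linarith) hD hE hs hsE h1 (by linarith) h4)

/-- Proposition 2(ii): the atomic player's optimal wager when betting on Outcome 2
is profitable. -/
theorem stmt_2 (κ q w : ℝ) (hκ : κ ∈ Ioo (0:ℝ) 1) (hq : q ∈ Icc (0:ℝ) 1) (hw : 0 < w)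
    (μ : Measure ℝ) (hμ : NiceDensity μ)
    (f : ℝ → ℝ × ℝ) (a : ℝ × ℝ) (hf : FeasibleDiffuse f) (ha : FeasibleAtomic w a)
    (hd1 : 0 < d1 μ f) (hd2 : 0 < d2 μ f)
    (hq2 : 1 - q > d2 μ f / (κ * (d1 μ f + d2 μ f))) :
    (a.1 * (κ * q / impliedProb μ f a - 1) +
        a.2 * (κ * (1 - q) / (1 - impliedProb μ f a) - 1) =
      sSup {x | ∃ b1 b2 : ℝ, 0 ≤ b1 ∧ 0 ≤ b2 ∧ b1 + b2 ≤ w ∧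
        x = b1 * (κ * q * (d1 μ f + d2 μ f + b1 + b2) / (d1 μ f + b1) - 1) +
          b2 * (κ * (1 - q) * (d1 μ f + d2 μ f + b1 + b2) / (d2 μ f + b2) - 1)})
    ↔ (a.1 = 0 ∧
        a.2 = min w (Real.sqrt (κ * (1 - q) * d1 μ f * d2 μ f / (1 - κ * (1 - q))) - d2 μ f)) := by
  obtain ⟨hk0, hk1⟩ := hκ
  obtain ⟨hq0, hq1⟩ := hq
  obtain ⟨ha1, ha2, ha3⟩ := ha
  unfold impliedProb
  generalize d1 μ f = D at *
  generalize d2 μ f = E at *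
  have hβ : E < κ * (1 - q) * (D + E) := by
    rw [gt_iff_lt, div_lt_iff₀ (by positivity)] at hq2
    linarith
  have hα : 0 ≤ κ * q := by positivity
  have hαβ : κ * q + κ * (1 - q) < 1 := by linarith
  have hβ1 : κ * (1 - q) < 1 := by linarith
  have hβ0 : 0 ≤ κ * (1 - q) := mul_nonneg hk0.le (by linarith)
  have hL : a.1 * (κ * q / ((D + a.1) / (D + E + a.1 + a.2)) - 1) +
        a.2 * (κ * (1 - q) / (1 - (D + a.1) / (D + E + a.1 + a.2)) - 1)
      = payoff (κ * q) (κ * (1 - q)) D E a.1 a.2 := by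
    have hS : D + E + a.1 + a.2 ≠ 0 := by positivity
    have : 1 - (D + a.1) / (D + E + a.1 + a.2) = (E + a.2) / (D + E + a.1 + a.2) := by
      field_simp; ring
    rw [this, div_div_eq_mul_div, div_div_eq_mul_div]
    rfl
  rw [hL]
  generalize κ * (1 - q) = β at *
  generalize κ * q = α at *
  have hb1 : 0 < 1 - β := by linarith
  have hs : (1 - β) * Real.sqrt (β * D * E / (1 - β)) ^ 2 = β * D * E := by
    rw [Real.sq_sqrt (by positivity)]
    field_simp
  have hsE : E < Real.sqrt (β * D * E / (1 - β)) := by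
    apply Real.lt_sqrt_of_sq_lt
    rw [lt_div_iff₀ hb1]
    nlinarith
  generalize Real.sqrt (β * D * E / (1 - β)) = s at *
  have hmain := fun b c => payoff_lt α β D E s w b c hα hαβ hd1 hd2 hβ hs hsE
  have hG : IsGreatest {x | ∃ b1 b2 : ℝ, 0 ≤ b1 ∧ 0 ≤ b2 ∧ b1 + b2 ≤ w ∧
        x = b1 * (α * (D + E + b1 + b2) / (D + b1) - 1) +
          b2 * (β * (D + E + b1 + b2) / (E + b2) - 1)} (payoff α β D E 0 (min w (s - E))) := by
    constructor
    · exact ⟨0, min w (s - E), le_rfl, le_min hw.le (by linarith),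
        by rw [zero_add]; exact min_le_left _ _, rfl⟩
    · rintro x ⟨b, c, hb, hc, hbc, rfl⟩
      by_cases h : b = 0 ∧ c = min w (s - E)
      · rw [h.1, h.2]; exact le_rfl
      · exact (hmain b c hb hc hbc h).le
  rw [hG.csSup_eq]
  constructor
  · intro h
    by_contra hne
    exact (hmain _ _ ha1 ha2 ha3 hne).ne h
  · rintro ⟨h1, h2⟩
    rw [h1, h2]
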